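/- Let A be continuous on M and let w be a nonnegative continuous function on M, with associated degenerate Agmon distance ρ. If h is a real-valued function on M satisfying |h(x) − h(y)| ≤ ρ(x,y) for all x, y ∈ M, then h is Lipschitz and |∇_A h(x)|² ≤ w(x) at almost every x ∈ M (h is differentiable almost everywhere by Rademacher's theorem). In particular, this conclusion holds for h(x) = inf_{y ∈ E} ρ(x,y) for any nonempty set E ⊆ M. -/

import Mathlib

open MeasureTheory Set Metric Filter
open scoped RealInnerProductSpace NNReal

noncomputable section

abbrev Euc (n : ℕ) := EuclideanSpace ℝ (Fin n)

/-- The bilinear form `ξ · (A ζ)` associated with a matrix `A`.  For a symmetric positive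
definite `A` one has `|∇_A f|² = mbilin A (∇f) (∇f)` where `∇_A f = A^{1/2} ∇ f`. -/
def mbilin {n : ℕ} (A : Matrix (Fin n) (Fin n) ℝ) (ξ ζ : Euc n) : ℝ :=
  ∑ i, ∑ j, A i j * ξ i * ζ j

/-- `F` is bi-Lipschitz with constant `ε` on `s`. -/
def BiLipOn {n : ℕ} (ε : ℝ) (s : Set (Euc n)) (F : Euc n → Euc n) : Prop :=
  ∀ y ∈ s, ∀ z ∈ s, ε * dist y z ≤ dist (F y) (F z) ∧ dist (F y) (F z) ≤ ε⁻¹ * dist y z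

/-- At every boundary point, `Ω` is locally bi-Lipschitz equivalent to a half space. -/
def BiLipschitzBoundary {n : ℕ} (Ω : Set (Euc n)) : Prop :=
  ∀ x ∈ frontier Ω, ∃ r > (0:ℝ), ∃ ε > (0:ℝ), ∃ F : Euc n → Euc n, ∃ v : Euc n,
    ‖v‖ = 1 ∧ BiLipOn ε (ball x r) F ∧
    F '' (ball x r ∩ Ω) = F '' (ball x r) ∩ {y : Euc n | 0 < ⟪v, y⟫}

/-- `f ∈ W^{1,2}(M)` with weak gradient `gf` : `f` is approximable in `W^{1,2}` norm by `C¹`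
functions.  (`W^{1,2}(M)` is the closure of `C¹(M)` in the `W^{1,2}` norm.) -/
def MemW12 {n : ℕ} (Ω : Set (Euc n)) (f : Euc n → ℝ) (gf : Euc n → Euc n) : Prop :=
  ∀ δ > (0:ℝ), ∃ g : Euc n → ℝ, ContDiff ℝ 1 g ∧
    (∫ x in Ω, (‖gradient g x - gf x‖ ^ 2 + (g x - f x) ^ 2)) < δ

/-- Uniform ellipticity with constant `C` on `Ω` : `C⁻¹|ξ|² ≤ ξ·A(x)ξ ≤ C|ξ|²`. -/
def UniformlyElliptic {n : ℕ} (Ω : Set (Euc n)) (C : ℝ)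
    (A : Euc n → Matrix (Fin n) (Fin n) ℝ) : Prop :=
  ∀ x ∈ Ω, ∀ ξ : Euc n, C⁻¹ * ‖ξ‖ ^ 2 ≤ mbilin (A x) ξ ξ ∧ mbilin (A x) ξ ξ ≤ C * ‖ξ‖ ^ 2

/-- `Lφ = f` weakly on `M = closure Ω` (weak Neumann problem):
`∫_Ω [(A∇φ)·∇η + Vφη] m dx = ∫_Ω f η m dx` for every `η ∈ W^{1,2}(M)`. -/
def WeakEq {n : ℕ} (Ω : Set (Euc n)) (m V : Euc n → ℝ)
    (A : Euc n → Matrix (Fin n) (Fin n) ℝ)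
    (φ : Euc n → ℝ) (gφ : Euc n → Euc n) (f : Euc n → ℝ) : Prop :=
  ∀ (η : Euc n → ℝ) (gη : Euc n → Euc n), MemW12 Ω η gη →
    (∫ x in Ω, (mbilin (A x) (gφ x) (gη x) + V x * φ x * η x) * m x)
      = ∫ x in Ω, f x * η x * m x


/-- `γ : [0,1] → Mset` is an absolutely continuous path from `x` to `y` with a.e. derivative
`dγ` (characterized by `γ s = x + ∫₀ˢ dγ`). -/
def ACPath {n : ℕ} (Mset : Set (Euc n)) (x y : Euc n) (γ dγ : ℝ → Euc n) : Prop :=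
  γ 0 = x ∧ γ 1 = y ∧ (∀ t ∈ Icc (0:ℝ) 1, γ t ∈ Mset) ∧
    IntervalIntegrable dγ volume 0 1 ∧
    ∀ s ∈ Icc (0:ℝ) 1, γ s = x + ∫ t in (0:ℝ)..s, dγ t

/-- Length of a path in the degenerate Agmon metric `ds² = w(x) Σ bᵢⱼ dxᵢ dxⱼ`, `B = A⁻¹`. -/
def agmonLen {n : ℕ} (A : Euc n → Matrix (Fin n) (Fin n) ℝ) (w : Euc n → ℝ)
    (γ dγ : ℝ → Euc n) : ℝ :=
  ∫ t in (0:ℝ)..1, Real.sqrt (w (γ t) * mbilin (A (γ t))⁻¹ (dγ t) (dγ t))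

/-- The Agmon distance `ρ(x,y)` associated to the weight `w` and the matrix `A` on `Mset`:
the infimum of the Agmon lengths of absolutely continuous paths in `Mset` from `x` to `y`. -/
def AgmonDist {n : ℕ} (Mset : Set (Euc n)) (A : Euc n → Matrix (Fin n) (Fin n) ℝ)
    (w : Euc n → ℝ) (x y : Euc n) : ℝ :=
  sInf {L | ∃ γ dγ : ℝ → Euc n, ACPath Mset x y γ dγ ∧ L = agmonLen A w γ dγ}

/-- `ρ(x,E) = inf_{y ∈ E} ρ(x,y)`. -/
def AgmonDistSet {n : ℕ} (Mset : Set (Euc n)) (A : Euc n → Matrix (Fin n) (Fin n) ℝ)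
    (w : Euc n → ℝ) (x : Euc n) (E : Set (Euc n)) : ℝ :=
  sInf {L | ∃ y ∈ E, L = AgmonDist Mset A w x y}

section Brouwer

open Module Polynomial in
theorem exists_interpolation_det {E : Type*} [NormedAddCommGroup E] [NormedSpace ℝ E]
    [FiniteDimensional ℝ E] {t : ℕ → ℝ} (ht : Function.Injective t) :
    ∃ c : ℕ → ℝ, ∀ L : E →L[ℝ] E, (1 + L).det =
      ∑ i ∈ Finset.range (finrank ℝ E + 1), c i * (1 + t i • L).det := by
  classical
  set s := Finset.range (finrank ℝ E + 1)
  refine ⟨fun i => (Lagrange.basis s t i).eval 1, fun L => ?_⟩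
  let b := Module.finBasis ℝ E
  let m : Matrix (Fin (finrank ℝ E)) (Fin (finrank ℝ E)) ℝ :=
    LinearMap.toMatrix b b (L : E →ₗ[ℝ] E)
  let P : ℝ[X] := Matrix.det ((X : ℝ[X]) • m.map C + (1 : Matrix _ _ ℝ).map C)
  have heval : ∀ r : ℝ, P.eval r = (1 + r • L).det := by
    intro r
    have h1 : (1 + r • L).det = Matrix.det (r • m + 1) := by
      rw [ContinuousLinearMap.det, ← LinearMap.det_toMatrix b]
      congr 1
      rw [add_comm]
      simp only [ContinuousLinearMap.toLinearMap_add, ContinuousLinearMap.toLinearMap_smul, map_add,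
        map_smul, m]
      congr 1
      exact LinearMap.toMatrix_one b
    rw [h1, ← Polynomial.coe_evalRingHom, RingHom.map_det]
    congr 1
    ext i j
    by_cases hij : i = j <;> simp [hij] <;> ring
  have hdeg : P.degree < s.card := by
    have h := Polynomial.natDegree_det_X_add_C_le m 1
    rw [Fintype.card_fin] at h
    refine lt_of_le_of_lt Polynomial.degree_le_natDegree ?_
    simp only [s, Finset.card_range]
    exact_mod_cast Nat.lt_succ_of_le h
  have h1 : (1 + L).det = P.eval 1 := by rw [heval, one_smul]
  rw [h1, Lagrange.eq_interpolate (v := t) ht.injOn hdeg, Lagrange.interpolate_apply,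
    Polynomial.eval_finsetSum]
  refine Finset.sum_congr rfl fun i _ => ?_
  rw [Polynomial.eval_mul, Polynomial.eval_C, heval, mul_comm]

theorem LipschitzOnWith.addHaar_image_null {E : Type*} [NormedAddCommGroup E] [NormedSpace ℝ E]
    [FiniteDimensional ℝ E] [MeasurableSpace E] [BorelSpace E] (μ : Measure E)
    [μ.IsAddHaarMeasure] {f : E → E} {s : Set E} {K : ℝ≥0} (hf : LipschitzOnWith K f s)
    (hs : μ s = 0) : μ (f '' s) = 0 := by
  let ν : Measure E := Measure.hausdorffMeasure (Module.finrank ℝ E)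
  have h1 : ν s = 0 := Measure.absolutelyContinuous_isAddHaarMeasure ν μ hs
  refine Measure.absolutelyContinuous_isAddHaarMeasure μ ν ?_
  refine le_antisymm ((hf.hausdorffMeasure_image_le (by positivity)).trans ?_) bot_le
  exact (congrArg _ h1).trans (mul_zero _) |>.le

variable {E : Type*} [NormedAddCommGroup E] [InnerProductSpace ℝ E] [FiniteDimensional ℝ E]

theorem image_ball_id_add_smul {g : E → E} {K : ℝ≥0} (hg : LipschitzWith K g) {R t : ℝ}
    (h0 : ∀ y, R ≤ ‖y‖ → g y = 0) (ht : 0 ≤ t) (htK : t * K < 1) :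
    Function.Injective (fun y => y + t • g y) ∧ (fun y => y + t • g y) '' ball 0 R = ball 0 R := by
  have hlip : ∀ y z, ‖t • g y - t • g z‖ ≤ t * K * ‖y - z‖ := by
    intro y z
    rw [← smul_sub, norm_smul, Real.norm_of_nonneg ht, mul_assoc]
    exact mul_le_mul_of_nonneg_left (by simpa [dist_eq_norm] using hg.dist_le_mul y z) ht
  have hinj : Function.Injective (fun y => y + t • g y) := by
    intro y z hyz
    have h1 : y - z = -(t • g y - t • g z) := by
      have h : y + t • g y = z + t • g z := hyz
      calc y - z = (y + t • g y) - (z + t • g z) - (t • g y - t • g z) := by abel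
        _ = _ := by rw [h, sub_self, zero_sub]
    have h2 : ‖y - z‖ ≤ t * K * ‖y - z‖ := by
      conv_lhs => rw [h1, norm_neg]
      exact hlip y z
    have h3 : ‖y - z‖ = 0 := by
      nlinarith [norm_nonneg (y - z)]
    exact sub_eq_zero.1 (norm_eq_zero.1 h3)
  have hsurj : ∀ p, ∃ y, y + t • g y = p := by
    intro p
    have hc : ContractingWith (⟨t * K, by positivity⟩ : ℝ≥0) (fun y => p - t • g y) := by
      refine ⟨by exact_mod_cast htK, LipschitzWith.of_dist_le_mul fun y z => ?_⟩
      rw [dist_eq_norm, dist_eq_norm, sub_sub_sub_cancel_left, norm_sub_rev]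
      exact hlip y z
    refine ⟨hc.fixedPoint _, ?_⟩
    have := hc.fixedPoint_isFixedPt
    exact (sub_eq_iff_eq_add.1 this).symm
  have hout : ∀ y, R ≤ ‖y‖ → y + t • g y = y := fun y hy => by simp [h0 y hy]
  refine ⟨hinj, Subset.antisymm ?_ ?_⟩
  · rintro _ ⟨y, hy, rfl⟩
    by_contra hcon
    simp only [mem_ball_zero_iff, not_lt] at hcon hy
    have h1 : y + t • g y = y := hinj (hout _ hcon)
    rw [h1] at hcon
    linarith
  · intro p hp
    obtain ⟨y, hy⟩ := hsurj p
    refine ⟨y, ?_, hy⟩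
    by_contra hcon
    simp only [mem_ball_zero_iff, not_lt] at hcon hp
    rw [hout y hcon] at hy
    rw [hy] at hcon
    linarith

variable [MeasurableSpace E] [BorelSpace E]

theorem integral_abs_det_one_add_smul_fderiv (μ : Measure E) [μ.IsAddHaarMeasure]
    {g : E → E} {K : ℝ≥0} (hg : LipschitzWith K g) {R t : ℝ}
    (h0 : ∀ y, R ≤ ‖y‖ → g y = 0) (ht : 0 ≤ t) (htK : t * K < 1) :
    ∫⁻ x in ball 0 R, ENNReal.ofReal |(1 + t • fderiv ℝ g x).det| ∂μ = μ (ball 0 R) := by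
  obtain ⟨hinj, him⟩ := image_ball_id_add_smul hg h0 ht htK
  set D : Set E := {x | DifferentiableAt ℝ g x}
  have hD : MeasurableSet D := measurableSet_of_differentiableAt ℝ g
  have hDc : μ Dᶜ = 0 := hg.ae_differentiableAt (μ := μ)
  have hs : MeasurableSet (ball 0 R ∩ D) := measurableSet_ball.inter hD
  have hd := lintegral_abs_det_fderiv_eq_addHaar_image μ (f := fun y => y + t • g y)
    (f' := fun x => 1 + t • fderiv ℝ g x) hs (fun x hx => by
      have h1 : HasFDerivAt g (fderiv ℝ g x) x := hx.2.hasFDerivAt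
      exact ((hasFDerivAt_id x).add (h1.const_smul t)).hasFDerivWithinAt) hinj.injOn
  have hae : (ball (0 : E) R ∩ D : Set E) =ᵐ[μ] ball 0 R := by
    refine inter_ae_eq_left_of_ae_eq_univ ?_
    exact eventuallyEq_univ.2 hDc
  rw [← setLIntegral_congr hae, hd]
  refine le_antisymm (measure_mono ((image_mono inter_subset_left).trans him.subset)) ?_
  have hlip : LipschitzWith (1 + ‖t‖₊ * K) (fun y => y + t • g y) :=
    LipschitzWith.id.add (((lipschitzWith_smul t).comp hg))
  have hnull : μ ((fun y => y + t • g y) '' Dᶜ) = 0 :=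
    (hlip.lipschitzOnWith (s := Dᶜ)).addHaar_image_null μ hDc
  calc μ (ball 0 R) = μ ((fun y => y + t • g y) '' ball 0 R) := by rw [him]
    _ ≤ μ ((fun y => y + t • g y) '' (ball 0 R ∩ D) ∪ (fun y => y + t • g y) '' Dᶜ) := by
        refine measure_mono ?_
        rw [← image_union]
        refine image_mono fun y hy => ?_
        by_cases h : y ∈ D
        · exact Or.inl ⟨hy, h⟩
        · exact Or.inr h
    _ ≤ _ := (measure_union_le _ _).trans (by rw [hnull, add_zero])

/-- The integral of the Jacobian determinant of a Lipschitz perturbation of the identity supported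
in a ball is the volume of the ball. -/
theorem integral_det_one_add_fderiv (μ : Measure E) [μ.IsAddHaarMeasure]
    {g : E → E} {K : ℝ≥0} (hg : LipschitzWith K g) {R : ℝ}
    (h0 : ∀ y, R ≤ ‖y‖ → g y = 0) :
    ∫ x in ball 0 R, (1 + fderiv ℝ g x).det ∂μ = μ.real (ball 0 R) := by
  have hcont : ∀ t : ℝ, Continuous fun L : E →L[ℝ] E => (1 + t • L).det := fun t =>
    ContinuousLinearMap.continuous_det.comp (by fun_prop)
  have hbd : ∀ x, ‖fderiv ℝ g x‖ ≤ K := fun x => norm_fderiv_le_of_lipschitz ℝ hg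
  have hint : ∀ t : ℝ, IntegrableOn (fun x => (1 + t • fderiv ℝ g x).det) (ball 0 R) μ := by
    intro t
    obtain ⟨B, hB⟩ := (isCompact_closedBall (0 : E →L[ℝ] E) K).exists_bound_of_continuousOn
      (hcont t).continuousOn
    refine Measure.integrableOn_of_bounded (M := B) measure_ball_lt_top.ne
      (((hcont t).measurable.comp (measurable_fderiv ℝ g)).aestronglyMeasurable) ?_
    exact ae_of_all _ fun x => hB _ (by simpa using hbd x)
  obtain ⟨η, hη, hpos⟩ : ∃ η > 0, ∀ L : E →L[ℝ] E, ‖L‖ < η → 0 < (1 + L).det := by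
    have h1 : ∀ᶠ L : E →L[ℝ] E in nhds 0, 0 < (1 + L).det := by
      have h2 := (hcont 1).continuousAt (x := 0)
      simp only [one_smul] at h2
      refine h2.eventually_const_lt ?_
      simp [ContinuousLinearMap.det]
    obtain ⟨η, hη, h⟩ := Metric.eventually_nhds_iff.1 h1
    exact ⟨η, hη, fun L hL => h (by simpa using hL)⟩
  set τ : ℝ := min η 1 / (K + 1)
  have hτ : 0 < τ := by positivity
  have hτK : τ * (K + 1) = min η 1 := by simp only [τ]; field_simp
  have hsmall : ∀ t, 0 < t → t ≤ τ →
      ∫ x in ball 0 R, (1 + t • fderiv ℝ g x).det ∂μ = μ.real (ball 0 R) := by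
    intro t ht htτ
    have htK : t * K < min η 1 := by
      have : t * K ≤ τ * K := by gcongr
      linarith
    have hdet : ∀ x, 0 < (1 + t • fderiv ℝ g x).det := by
      intro x
      refine hpos _ ?_
      rw [norm_smul, Real.norm_of_nonneg ht.le]
      exact lt_of_le_of_lt (mul_le_mul_of_nonneg_left (hbd x) ht.le)
        (htK.trans_le (min_le_left _ _))
    rw [integral_eq_lintegral_of_nonneg_ae (ae_of_all _ fun x => (hdet x).le)
      (hint t).aestronglyMeasurable, Measure.real,
      ← integral_abs_det_one_add_smul_fderiv μ hg h0 ht.le (htK.trans_le (min_le_right _ _))]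
    congr 1
    refine lintegral_congr fun x => ?_
    rw [abs_of_pos (hdet x)]
  obtain ⟨c, hc⟩ := exists_interpolation_det (E := E) (t := fun i : ℕ => τ / (i + 1)) (by
    intro i j hij
    have h1 : (i : ℝ) + 1 = j + 1 := by
      have hi : (0 : ℝ) < i + 1 := by positivity
      have hj : (0 : ℝ) < j + 1 := by positivity
      simp only at hij
      field_simp at hij
      linarith
    exact_mod_cast add_right_cancel h1)
  have hsum : ∑ i ∈ Finset.range (Module.finrank ℝ E + 1), c i = 1 := by
    have h1 : (1 : E →L[ℝ] E).det = 1 := by simp [ContinuousLinearMap.det]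
    simpa only [smul_zero, add_zero, h1, mul_one] using (hc 0).symm
  rw [integral_congr_ae (ae_of_all _ fun x => hc (fderiv ℝ g x))]
  rw [integral_finsetSum _ fun i _ => (hint _).const_mul _]
  simp_rw [integral_const_mul]
  have : ∀ i : ℕ, ∫ x in ball 0 R, (1 + (τ / (i + 1)) • fderiv ℝ g x).det ∂μ = μ.real (ball 0 R) :=
    fun i => hsmall _ (by positivity) (div_le_self hτ.le (by linarith [Nat.cast_nonneg (α := ℝ) i]))
  simp_rw [this]
  rw [← Finset.sum_mul, hsum, one_mul]

omit [MeasurableSpace E] [BorelSpace E] in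
/-- There is no Lipschitz retraction of a ball onto its boundary sphere. -/
theorem not_lipschitz_retraction {f : E → E} {K : ℝ≥0} (hf : LipschitzWith K f) {R : ℝ}
    (hR : 0 < R) (hout : ∀ y, R ≤ ‖y‖ → f y = y) (hin : ∀ y, ‖y‖ ≤ R → ‖f y‖ = R) : False := by
  borelize E
  let μ : Measure E := Measure.addHaar
  set g : E → E := fun y => f y - y
  have hg : LipschitzWith (K + 1) g := hf.sub LipschitzWith.id
  have h := integral_det_one_add_fderiv μ hg (R := R) (fun y hy => by simp [g, hout y hy])
  have hpos : 0 < μ.real (ball 0 R) :=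
    ENNReal.toReal_pos (measure_ball_pos μ 0 hR).ne' measure_ball_lt_top.ne
  have hz : ∫ x in ball 0 R, (1 + fderiv ℝ g x).det ∂μ = 0 := by
    refine setIntegral_eq_zero_of_ae_eq_zero ?_
    filter_upwards [hg.ae_differentiableAt (μ := μ)] with x hx hxR
    have hfx : HasFDerivAt f (1 + fderiv ℝ g x) x := by
      have := (hasFDerivAt_id x).add hx.hasFDerivAt
      refine this.congr_of_eventuallyEq (Eventually.of_forall fun y => ?_)
      simp [g]
    have hconst : HasFDerivAt (fun y => ‖f y‖ ^ 2) (0 : E →L[ℝ] ℝ) x := by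
      refine (hasFDerivAt_const (R ^ 2) x).congr_of_eventuallyEq ?_
      filter_upwards [isOpen_ball.mem_nhds hxR] with y hy
      rw [hin y (mem_ball_zero_iff.1 hy).le]
    have hEq := hconst.unique hfx.norm_sq
    by_contra hdet
    have hu : IsUnit (1 + fderiv ℝ g x : E →L[ℝ] E).toLinearMap :=
      (LinearMap.isUnit_iff_isUnit_det _).2 (isUnit_iff_ne_zero.2 hdet)
    obtain ⟨v, hv⟩ := ((Module.End.isUnit_iff _).1 hu).2 (f x)
    have h1 := DFunLike.congr_fun hEq v
    have hv' : (1 + fderiv ℝ g x) v = f x := hv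
    have h2 := hin x (mem_ball_zero_iff.1 hxR).le
    change (0 : ℝ) = 2 • inner ℝ (f x) ((1 + fderiv ℝ g x) v) at h1
    rw [hv', real_inner_self_eq_norm_sq, h2] at h1
    simp [hR.ne'] at h1
  linarith

end Brouwer

section InvarianceOfDomain

theorem exists_lipschitzOnWith_smul {X F : Type*} [PseudoMetricSpace X] [NormedAddCommGroup F]
    [NormedSpace ℝ F] {s : Set X} (hs : IsCompact s) {u : X → ℝ} {v : X → F}
    (hu : ∃ K, LipschitzOnWith K u s) (hv : ∃ K, LipschitzOnWith K v s) :
    ∃ K, LipschitzOnWith K (fun x => u x • v x) s := by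
  obtain ⟨Ku, hu⟩ := hu
  obtain ⟨Kv, hv⟩ := hv
  obtain ⟨a, ha⟩ := hs.exists_bound_of_continuousOn hu.continuousOn
  obtain ⟨b, hb⟩ := hs.exists_bound_of_continuousOn hv.continuousOn
  refine ⟨(Ku * b + a * Kv).toNNReal, LipschitzOnWith.of_dist_le_mul fun x hx y hy => ?_⟩
  have h1 := hu.dist_le_mul x hx y hy
  have h2 := hv.dist_le_mul x hx y hy
  have ha0 := (norm_nonneg _).trans (ha y hy)
  calc dist (u x • v x) (u y • v y) = ‖(u x - u y) • v x + u y • (v x - v y)‖ := by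
        rw [dist_eq_norm, sub_smul, smul_sub]; congr 1; abel
    _ ≤ dist (u x) (u y) * ‖v x‖ + ‖u y‖ * dist (v x) (v y) := by
        refine (norm_add_le _ _).trans ?_
        rw [norm_smul, norm_smul, dist_eq_norm, dist_eq_norm]
    _ ≤ (Ku * dist x y) * b + a * (Kv * dist x y) := by
        gcongr
        · exact hb x hx
        · exact ha y hy
    _ = (Ku * b + a * Kv) * dist x y := by ring
    _ ≤ _ := mul_le_mul_of_nonneg_right (Real.le_coe_toNNReal _) dist_nonneg

theorem exists_lipschitzOnWith_normalize {X F : Type*} [PseudoMetricSpace X]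
    [NormedAddCommGroup F] [NormedSpace ℝ F] {s : Set X} (hs : IsCompact s) {v : X → F}
    (hv : ∃ K, LipschitzOnWith K v s) (h0 : ∀ x ∈ s, v x ≠ 0) :
    ∃ K, LipschitzOnWith K (fun x => ‖v x‖⁻¹ • v x) s := by
  refine exists_lipschitzOnWith_smul hs ?_ hv
  obtain ⟨K, hv⟩ := hv
  have hinv : ContinuousOn (fun x => ‖v x‖⁻¹) s :=
    hv.continuousOn.norm.inv₀ fun x hx => norm_ne_zero_iff.2 (h0 x hx)
  obtain ⟨a, ha⟩ := hs.exists_bound_of_continuousOn hinv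
  simp only [norm_inv, norm_norm] at ha
  refine ⟨(K * (a * a)).toNNReal, LipschitzOnWith.of_dist_le_mul fun x hx y hy => ?_⟩
  have hx0 := norm_pos_iff.2 (h0 x hx)
  have hy0 := norm_pos_iff.2 (h0 y hy)
  have ha0 := (inv_nonneg.2 (norm_nonneg _)).trans (ha y hy)
  have h1 : |‖v y‖ - ‖v x‖| ≤ K * dist x y := by
    rw [dist_comm]
    exact (abs_norm_sub_norm_le _ _).trans
      (by simpa [dist_eq_norm] using hv.dist_le_mul y hy x hx)
  calc dist ‖v x‖⁻¹ ‖v y‖⁻¹ = |‖v y‖ - ‖v x‖| * (‖v x‖⁻¹ * ‖v y‖⁻¹) := by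
        rw [Real.dist_eq, inv_sub_inv hx0.ne' hy0.ne', abs_div, abs_of_pos (mul_pos hx0 hy0),
          div_eq_mul_inv, mul_inv]
    _ ≤ (K * dist x y) * (a * a) := by
        gcongr
        · exact ha x hx
        · exact ha y hy
    _ = K * (a * a) * dist x y := by ring
    _ ≤ _ := mul_le_mul_of_nonneg_right (Real.le_coe_toNNReal _) dist_nonneg

theorem LipschitzOnWith.lipschitzWith_of_eq_zero {E F : Type*} [NormedAddCommGroup E]
    [NormedSpace ℝ E] [NormedAddCommGroup F] {g : E → F} {K : ℝ≥0} {R : ℝ}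
    (hg : LipschitzOnWith K g (closedBall 0 R)) (h0 : ∀ y, R ≤ ‖y‖ → g y = 0) :
    LipschitzWith K g := by
  have key : ∀ y z : E, ‖y‖ ≤ R → R ≤ ‖z‖ → dist (g y) (g z) ≤ K * dist y z := by
    intro y z hy hz
    have hc : ContinuousOn (fun τ : ℝ => ‖AffineMap.lineMap y z τ‖) (Icc 0 1) := by
      have : Continuous (AffineMap.lineMap y z : ℝ → E) := AffineMap.lineMap_continuous
      exact this.norm.continuousOn
    obtain ⟨τ, hτ, hτR⟩ := intermediate_value_Icc zero_le_one hc
      (show R ∈ Icc _ _ by simpa using ⟨hy, hz⟩)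
    have hτR' : ‖(AffineMap.lineMap y z τ : E)‖ = R := hτR
    rw [h0 z hz, ← h0 _ hτR'.ge]
    refine (hg.dist_le_mul y (by simpa using hy) _ (by simpa using hτR'.le)).trans ?_
    refine mul_le_mul_of_nonneg_left ?_ K.2
    rw [dist_left_lineMap, Real.norm_of_nonneg hτ.1]
    exact mul_le_of_le_one_left dist_nonneg hτ.2
  refine LipschitzWith.of_dist_le_mul fun y z => ?_
  rcases le_total ‖y‖ R with hy | hy <;> rcases le_total ‖z‖ R with hz | hz
  · exact hg.dist_le_mul y (by simpa using hy) z (by simpa using hz)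
  · exact key y z hy hz
  · rw [dist_comm, dist_comm y]
    exact key z y hz hy
  · rw [h0 y hy, h0 z hz, dist_self]
    positivity

variable {E : Type*} [NormedAddCommGroup E] [InnerProductSpace ℝ E] [FiniteDimensional ℝ E]

theorem LipschitzOnWith.exists_eq_zero_of_norm_sub_le {H : E → E} {K : ℝ≥0} {r : ℝ} (hr : 0 < r)
    (hH : LipschitzOnWith K H (closedBall 0 r))
    (hclose : ∀ y ∈ closedBall (0 : E) r, ‖H y - y‖ ≤ r / 4) :
    ∃ y ∈ closedBall (0 : E) r, H y = 0 := by
  by_contra! hne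
  have hcpt : IsCompact (closedBall (0 : E) r) := isCompact_closedBall _ _
  have hid : LipschitzOnWith 1 (fun y : E => y) (closedBall 0 r) :=
    LipschitzWith.id.lipschitzOnWith
  set χ : E → ℝ := fun y => max 0 (min 1 (2 - 2 / r * ‖y‖))
  have hχ : ∃ K, LipschitzOnWith K χ (closedBall (0 : E) r) := by
    have h1 : LipschitzWith (‖2 / r‖₊ * 1) (fun y : E => 2 / r * ‖y‖) :=
      (lipschitzWith_smul (2 / r)).comp lipschitzWith_one_norm
    exact ⟨_, ((((LipschitzWith.const 2).sub h1).const_min 1).const_max 0).lipschitzOnWith⟩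
  set H₁ : E → E := fun y => y + χ y • (H y - y)
  have hH₁ : ∃ K, LipschitzOnWith K H₁ (closedBall 0 r) := by
    obtain ⟨K', hK'⟩ := exists_lipschitzOnWith_smul hcpt hχ ⟨_, hH.sub hid⟩
    exact ⟨_, hid.add hK'⟩
  have hχ0 : ∀ y, 0 ≤ χ y := fun y => le_max_left _ _
  have hχ1 : ∀ y, χ y ≤ 1 := fun y => max_le zero_le_one (min_le_left _ _)
  have hH₁ne : ∀ y ∈ closedBall (0 : E) r, H₁ y ≠ 0 := by
    intro y hy h0
    rcases le_or_gt ‖y‖ (r / 2) with hyr | hyr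
    · have h1 : χ y = 1 := by
        have : 2 / r * ‖y‖ ≤ 1 := by
          rw [div_mul_eq_mul_div, div_le_one hr]; linarith
        simp only [χ]
        rw [min_eq_left (by linarith), max_eq_right zero_le_one]
      refine hne y hy ?_
      simpa [H₁, h1] using h0
    · have h1 : y = -(χ y • (H y - y)) := eq_neg_of_add_eq_zero_left h0
      have h2 : ‖y‖ ≤ 1 * (r / 4) := by
        conv_lhs => rw [h1, norm_neg, norm_smul, Real.norm_of_nonneg (hχ0 y)]
        exact mul_le_mul (hχ1 y) (hclose y hy) (norm_nonneg _) zero_le_one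
      linarith
  have hbdry : ∀ y : E, ‖y‖ = r → H₁ y = y := by
    intro y hy
    have h1 : χ y = 0 := by
      simp only [χ, hy]
      rw [div_mul_cancel₀ _ hr.ne', sub_self]
      simp
    simp [H₁, h1]
  set N : E → E := fun y => r • (‖H₁ y‖⁻¹ • H₁ y)
  obtain ⟨K', hK'⟩ := exists_lipschitzOnWith_smul hcpt
    ⟨0, (LipschitzWith.const r).lipschitzOnWith⟩ (exists_lipschitzOnWith_normalize hcpt hH₁ hH₁ne)
  set g : E → E := fun y => if ‖y‖ ≤ r then N y - y else 0
  have hg : LipschitzWith (K' + 1) g := by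
    refine LipschitzOnWith.lipschitzWith_of_eq_zero (R := r) ?_ ?_
    · intro y hy z hz
      have hgN : ∀ y ∈ closedBall (0 : E) r, g y = N y - y := fun y hy => by
        simp [g, mem_closedBall_zero_iff.1 hy]
      rw [hgN y hy, hgN z hz]
      exact (hK'.sub hid) hy hz
    · intro y hy
      rcases hy.lt_or_eq with hy | hy
      · simp [g, hy]
      · have hy' : ‖y‖ = r := hy.symm
        simp [g, N, hbdry y hy', hy', smul_smul, hr.ne']
  refine not_lipschitz_retraction (f := fun y => g y + y) (hg.add LipschitzWith.id) hr ?_ ?_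
  · intro y hy
    rcases hy.lt_or_eq with hy | hy
    · simp [g, hy]
    · have hy' : ‖y‖ = r := hy.symm
      simp [g, N, hbdry y hy', hy', smul_smul, hr.ne']
  · intro y hy
    have h1 := norm_ne_zero_iff.2 (hH₁ne y (by simpa using hy))
    simp [g, hy, N, norm_smul, h1, abs_of_pos hr]

/-- Invariance of domain for bi-Lipschitz maps. -/
theorem LipschitzOnWith.image_closedBall_mem_nhds {F : E → E} {x : E} {r ε : ℝ} {L : ℝ≥0}
    (hr : 0 < r) (hε : 0 < ε) (hF : LipschitzOnWith L F (closedBall x r))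
    (hF' : ∀ y ∈ closedBall x r, ∀ z ∈ closedBall x r, ε * dist y z ≤ dist (F y) (F z)) :
    F '' closedBall x r ∈ nhds (F x) := by
  borelize E
  let μ : Measure E := Measure.addHaar
  set f : E → E := fun y => F (x + y)
  set B : Set E := closedBall 0 r
  have hmem : ∀ y ∈ B, x + y ∈ closedBall x r := fun y hy => by simpa [B] using hy
  have hf : LipschitzOnWith L f B := LipschitzOnWith.of_dist_le_mul fun y hy z hz => by
    simpa using hF.dist_le_mul _ (hmem y hy) _ (hmem z hz)
  have hf' : ∀ y ∈ B, ∀ z ∈ B, ε * dist y z ≤ dist (f y) (f z) := fun y hy z hz => by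
    simpa using hF' _ (hmem y hy) _ (hmem z hz)
  have himage : f '' B = F '' closedBall x r := by
    have : (fun y => x + y) '' B = closedBall x r := by simp [B]
    rw [← this, image_image]
  have hBc : IsCompact B := isCompact_closedBall _ _
  have h0B : (0 : E) ∈ B := by simp [B, hr.le]
  have hinj : InjOn f B := fun y hy z hz h => by
    have h1 := hf' y hy z hz
    rw [h, dist_self] at h1
    exact dist_le_zero.1 (nonpos_of_mul_nonpos_right h1 hε)
  obtain ⟨G, hG, hGf⟩ : ∃ G : E → E, (∃ K, LipschitzWith K G) ∧ ∀ y ∈ B, G (f y) = y := by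
    have h1 : LipschitzOnWith (ε⁻¹).toNNReal (Function.invFunOn f B) (f '' B) := by
      refine LipschitzOnWith.of_dist_le_mul ?_
      rintro _ ⟨y, hy, rfl⟩ _ ⟨z, hz, rfl⟩
      rw [hinj.leftInvOn_invFunOn hy, hinj.leftInvOn_invFunOn hz,
        Real.coe_toNNReal _ (by positivity), inv_mul_eq_div, le_div_iff₀' hε]
      exact hf' y hy z hz
    obtain ⟨G, hG, hGe⟩ := h1.extend_finite_dimension
    exact ⟨G, ⟨_, hG⟩, fun y hy => by
      rw [← hGe (mem_image_of_mem f hy), hinj.leftInvOn_invFunOn hy]⟩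
  obtain ⟨Λ, hG⟩ := hG
  set δ : ℝ := r / (8 * (Λ + 1))
  have hδ : 0 < δ := by positivity
  have hδΛ : Λ * δ ≤ r / 8 := by
    have : δ * (Λ + 1) = r / 8 := by simp only [δ]; field_simp
    nlinarith
  refine mem_of_superset (ball_mem_nhds (F x) hδ) fun c hc => ?_
  rw [← himage]
  by_contra hcn
  have hf0 : f 0 = F x := by simp [f]
  rw [← hf0, mem_ball] at hc
  set δ' : ℝ := δ - dist c (f 0)
  have hδ' : 0 < δ' := sub_pos.2 hc
  obtain ⟨a, ha, haG⟩ : ∃ a ∈ ball (0 : E) (min (r / 8) (δ' / (L + 1))), a ∉ G '' sphere c δ := by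
    have h1 : μ (G '' sphere c δ) = 0 :=
      hG.lipschitzOnWith.addHaar_image_null μ (Measure.addHaar_sphere_of_ne_zero μ c hδ.ne')
    by_contra! hcon
    exact (measure_ball_pos μ (0 : E) (r := min (r / 8) (δ' / (L + 1))) (by positivity)).ne'
      (measure_mono_null hcon h1)
  rw [mem_ball_zero_iff, lt_min_iff] at ha
  set u : E → E := fun y => f y - c
  have hune : ∀ y ∈ B, u y ≠ 0 := fun y hy h => hcn ⟨y, hy, sub_eq_zero.1 h⟩
  have hu : LipschitzOnWith (L + 0) u B := hf.sub (LipschitzWith.const c).lipschitzOnWith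
  set Φ : E → E := fun y => c + max δ ‖u y‖ • (‖u y‖⁻¹ • u y)
  obtain ⟨K, hΦ⟩ : ∃ K, LipschitzOnWith K Φ B := by
    obtain ⟨K, hK⟩ := exists_lipschitzOnWith_smul hBc (u := fun y => max δ ‖u y‖)
      ⟨_, (lipschitzWith_one_norm.const_max δ).comp_lipschitzOnWith hu⟩
      (exists_lipschitzOnWith_normalize hBc ⟨_, hu⟩ hune)
    exact ⟨_, (LipschitzWith.const c).lipschitzOnWith.add hK⟩
  have hΦ1 : ∀ y ∈ B, δ ≤ ‖u y‖ → Φ y = f y := by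
    intro y hy h
    simp only [Φ]
    rw [max_eq_right h, smul_smul, mul_inv_cancel₀ (norm_ne_zero_iff.2 (hune y hy)), one_smul]
    simp [u]
  have hΦ2 : ∀ y ∈ B, ‖u y‖ ≤ δ → Φ y ∈ sphere c δ := by
    intro y hy h
    simp only [Φ]
    rw [max_eq_left h]
    simp [norm_smul, norm_ne_zero_iff.2 (hune y hy), abs_of_pos hδ]
  have hΦclose : ∀ y ∈ B, ‖Φ y - f y‖ ≤ δ := by
    intro y hy
    rcases le_total δ ‖u y‖ with h | h
    · rw [hΦ1 y hy h, sub_self, norm_zero]; exact hδ.le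
    · have hn := norm_pos_iff.2 (hune y hy)
      have h1 : Φ y - f y = (δ - ‖u y‖) • (‖u y‖⁻¹ • u y) := by
        simp only [Φ]
        rw [max_eq_left h, sub_smul, smul_smul ‖u y‖, mul_inv_cancel₀ hn.ne', one_smul]
        simp only [u]; abel
      rw [h1, norm_smul, norm_smul, norm_inv, norm_norm, inv_mul_cancel₀ hn.ne', mul_one,
        Real.norm_of_nonneg (sub_nonneg.2 h)]
      linarith
  obtain ⟨y, hy, hy0⟩ := LipschitzOnWith.exists_eq_zero_of_norm_sub_le hr
    (H := fun y => G (Φ y) - a)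
    ((hG.comp_lipschitzOnWith hΦ).sub (LipschitzWith.const a).lipschitzOnWith) (by
      intro y hy
      have h1 : ‖G (Φ y) - y‖ ≤ r / 8 := by
        have h2 : ‖G (Φ y) - y‖ = dist (G (Φ y)) (G (f y)) := by rw [hGf y hy, dist_eq_norm]
        refine (h2.trans_le (hG.dist_le_mul _ _)).trans (le_trans ?_ hδΛ)
        rw [dist_eq_norm]
        exact mul_le_mul_of_nonneg_left (hΦclose y hy) Λ.2
      calc ‖G (Φ y) - a - y‖ = ‖(G (Φ y) - y) - a‖ := by congr 1; abel
        _ ≤ ‖G (Φ y) - y‖ + ‖a‖ := _root_.norm_sub_le _ _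
        _ ≤ r / 4 := by linarith [ha.1])
  have hya : G (Φ y) = a := sub_eq_zero.1 hy0
  rcases le_total δ ‖u y‖ with h | h
  · rw [hΦ1 y hy h, hGf y hy] at hya
    have h1 : δ' ≤ L * ‖a‖ := by
      have h2 := hf.dist_le_mul y hy 0 h0B
      rw [dist_zero_right, hya] at h2
      have h3 : δ ≤ dist (f a) c := by rw [← hya, dist_eq_norm]; exact h
      have h4 := dist_triangle (f a) (f 0) c
      simp only [δ']
      rw [dist_comm c]
      linarith
    have h2 := (lt_div_iff₀ (by positivity : (0 : ℝ) < L + 1)).1 ha.2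
    nlinarith [norm_nonneg a]
  · exact haG ⟨Φ y, hΦ2 y hy h, hya⟩

end InvarianceOfDomain

section LipschitzPaths

/-- Near each of its points, the closure of an open set with bi-Lipschitz boundary is
quasiconvex. -/
theorem BiLipschitzBoundary.exists_lipschitz_path {n : ℕ} {Ω : Set (Euc n)} (hΩo : IsOpen Ω)
    (hΩl : BiLipschitzBoundary Ω) {x : Euc n} (hx : x ∈ closure Ω) :
    ∃ s > (0 : ℝ), ∃ c : ℝ≥0, ∀ z ∈ closure Ω ∩ ball x s, ∀ z' ∈ closure Ω ∩ ball x s,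
      ∃ γ : ℝ → Euc n, γ 0 = z ∧ γ 1 = z' ∧ MapsTo γ (Icc 0 1) (closure Ω) ∧
        LipschitzOnWith (c * nndist z z') γ (Icc 0 1) := by
  by_cases hxΩ : x ∈ Ω
  · obtain ⟨s, hs, hsΩ⟩ := Metric.isOpen_iff.1 hΩo x hxΩ
    refine ⟨s, hs, 1, fun z hz z' hz' =>
      ⟨AffineMap.lineMap z z', by simp, by simp, fun t ht => ?_, ?_⟩⟩
    · exact subset_closure (hsΩ ((convex_ball x s).lineMap_mem hz.2 hz'.2 ht))
    · refine (LipschitzWith.of_dist_le_mul fun t t' => ?_).lipschitzOnWith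
      rw [dist_lineMap_lineMap, mul_comm]
      simp
  obtain ⟨r, hr, ε, hε, F, v, hv, hF, hFΩ⟩ := hΩl x ⟨hx, by rwa [hΩo.interior_eq]⟩
  have hxr : x ∈ ball x r := mem_ball_self hr
  have hFlip : LipschitzOnWith (ε⁻¹).toNNReal F (ball x r) :=
    LipschitzOnWith.of_dist_le_mul fun y hy z hz => by
      rw [Real.coe_toNNReal _ (by positivity)]
      exact (hF y hy z hz).2
  have hsub : closedBall x (r / 2) ⊆ ball x r := closedBall_subset_ball (by linarith)
  obtain ⟨δ, hδ, hδF⟩ := Metric.mem_nhds_iff.1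
    ((hFlip.mono hsub).image_closedBall_mem_nhds (half_pos hr) hε
      fun y hy z hz => (hF y (hsub hy) z (hsub hz)).1)
  replace hδF : ball (F x) δ ⊆ F '' ball x r := hδF.trans (image_mono hsub)
  have hinj : InjOn F (ball x r) := fun y hy z hz h => by
    have h1 := (hF y hy z hz).1
    rw [h, dist_self] at h1
    exact dist_le_zero.1 (nonpos_of_mul_nonpos_right h1 hε)
  set g := Function.invFunOn F (ball x r)
  have hgF : ∀ y ∈ ball x r, g (F y) = y := fun y hy => hinj.leftInvOn_invFunOn hy
  have hglip : ∀ p ∈ ball (F x) δ, ∀ q ∈ ball (F x) δ, dist (g p) (g q) ≤ ε⁻¹ * dist p q := by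
    intro p hp q hq
    obtain ⟨y, hy, rfl⟩ := hδF hp
    obtain ⟨z, hz, rfl⟩ := hδF hq
    rw [hgF y hy, hgF z hz, inv_mul_eq_div, le_div_iff₀' hε]
    exact (hF y hy z hz).1
  have hpos : ∀ p ∈ ball (F x) δ, 0 < ⟪v, p⟫ → g p ∈ Ω := by
    intro p hp h
    have h1 : p ∈ F '' (ball x r ∩ Ω) := hFΩ ▸ ⟨hδF hp, h⟩
    obtain ⟨y, hy, rfl⟩ := h1
    rw [hgF y hy.1]
    exact hy.2
  have hnonneg : ∀ p ∈ ball (F x) δ, 0 ≤ ⟪v, p⟫ → g p ∈ closure Ω := by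
    intro p hp h
    refine Metric.mem_closure_iff.2 fun η hη => ?_
    set τ := min ((δ - dist p (F x)) / 2) (ε * η / 2)
    have hp' : 0 < δ - dist p (F x) := sub_pos.2 hp
    have hτ : 0 < τ := by positivity
    have hd : dist p (p + τ • v) = τ := by simp [norm_smul, hv, abs_of_pos hτ]
    have hmem : p + τ • v ∈ ball (F x) δ := by
      have h1 := dist_triangle (p + τ • v) p (F x)
      rw [dist_comm _ p, hd] at h1
      have h2 : τ ≤ (δ - dist p (F x)) / 2 := min_le_left _ _
      rw [mem_ball]
      linarith
    refine ⟨g (p + τ • v), hpos _ hmem ?_, (hglip p hp _ hmem).trans_lt ?_⟩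
    · rw [inner_add_right, inner_smul_right, real_inner_self_eq_norm_sq, hv]
      nlinarith
    · rw [hd, inv_mul_eq_div, div_lt_iff₀' hε]
      have h2 : τ ≤ ε * η / 2 := min_le_right _ _
      have : 0 < ε * η := by positivity
      linarith
  have hhalf : ∀ z ∈ closure Ω ∩ ball x r, 0 ≤ ⟪v, F z⟫ := by
    intro z hz
    have h1 : z ∈ closure (ball x r ∩ Ω) := isOpen_ball.inter_closure ⟨hz.2, hz.1⟩
    have h2 : ContinuousWithinAt F (ball x r ∩ Ω) z :=
      (hFlip.continuousOn z hz.2).mono inter_subset_left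
    have h3 : F z ∈ closure {y : Euc n | 0 ≤ ⟪v, y⟫} := by
      refine h2.mem_closure h1 fun y hy => ?_
      have h4 : F y ∈ F '' ball x r ∩ {y : Euc n | 0 < ⟪v, y⟫} := hFΩ ▸ mem_image_of_mem F hy
      exact (le_of_lt h4.2 : (0 : ℝ) ≤ ⟪v, F y⟫)
    rwa [(isClosed_le continuous_const (by fun_prop)).closure_eq] at h3
  set s := min r (ε * δ)
  have hs : ∀ z ∈ ball x s, z ∈ ball x r ∧ F z ∈ ball (F x) δ := by
    intro z hz
    have hzr : z ∈ ball x r := ball_subset_ball (min_le_left _ _) hz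
    refine ⟨hzr, ((hF z hzr x hxr).2).trans_lt ?_⟩
    rw [inv_mul_eq_div, div_lt_iff₀' hε]
    exact lt_of_lt_of_le hz (min_le_right _ _)
  refine ⟨s, by positivity, (ε⁻¹ * ε⁻¹).toNNReal, fun z hz z' hz' => ?_⟩
  obtain ⟨hzr, hzF⟩ := hs z hz.2
  obtain ⟨hzr', hzF'⟩ := hs z' hz'.2
  have hseg : ∀ t ∈ Icc (0 : ℝ) 1, AffineMap.lineMap (F z) (F z') t ∈ ball (F x) δ :=
    fun t ht => (convex_ball _ _).lineMap_mem hzF hzF' ht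
  refine ⟨fun t => g (AffineMap.lineMap (F z) (F z') t), by simp [hgF z hzr],
    by simp [hgF z' hzr'], fun t ht => hnonneg _ (hseg t ht) ?_,
    LipschitzOnWith.of_dist_le_mul fun t ht t' ht' => ?_⟩
  · rw [AffineMap.lineMap_apply_module, inner_add_right, inner_smul_right, inner_smul_right]
    have h1 := hhalf z ⟨hz.1, hzr⟩
    have h2 := hhalf z' ⟨hz'.1, hzr'⟩
    have h3 := ht.1
    have h4 := sub_nonneg.2 ht.2
    positivity
  · refine (hglip _ (hseg t ht) _ (hseg t' ht')).trans ?_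
    rw [dist_lineMap_lineMap]
    have h1 := (hF z hzr z' hzr').2
    have h2 : (0 : ℝ) ≤ ε⁻¹ := by positivity
    push_cast
    rw [Real.coe_toNNReal _ (by positivity)]
    calc ε⁻¹ * (dist t t' * dist (F z) (F z')) ≤ ε⁻¹ * (dist t t' * (ε⁻¹ * dist z z')) := by gcongr
      _ = _ := by ring

end LipschitzPaths

section MatrixForm

open Matrix

variable {n : ℕ}

theorem mbilin_eq_dotProduct (A : Matrix (Fin n) (Fin n) ℝ) (ξ ζ : Euc n) :
    mbilin A ξ ζ = ξ.ofLp ⬝ᵥ (A *ᵥ ζ.ofLp) := by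
  simp only [mbilin, dotProduct, mulVec, Finset.mul_sum]
  exact Finset.sum_congr rfl fun i _ => Finset.sum_congr rfl fun j _ => by ring

theorem mbilin_smul_smul (A : Matrix (Fin n) (Fin n) ℝ) (c : ℝ) (ξ : Euc n) :
    mbilin A (c • ξ) (c • ξ) = c ^ 2 * mbilin A ξ ξ := by
  simp only [mbilin, Finset.mul_sum, PiLp.smul_apply, smul_eq_mul]
  exact Finset.sum_congr rfl fun i _ => Finset.sum_congr rfl fun j _ => by ring

theorem inner_toLp_mulVec (A : Matrix (Fin n) (Fin n) ℝ) (ξ η : Euc n) :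
    ⟪ξ, WithLp.toLp 2 (A *ᵥ η.ofLp)⟫ = mbilin A ξ η := by
  rw [mbilin_eq_dotProduct, EuclideanSpace.inner_eq_star_dotProduct, dotProduct_comm]
  simp

variable {A : Matrix (Fin n) (Fin n) ℝ} {C : ℝ}

theorem isUnit_det_of_elliptic (hC : 0 < C) (hA : ∀ ξ : Euc n, C⁻¹ * ‖ξ‖ ^ 2 ≤ mbilin A ξ ξ) :
    IsUnit A.det := by
  by_contra hdet
  obtain ⟨v, hv, hAv⟩ := exists_mulVec_eq_zero_iff.2
    (by simpa [isUnit_iff_ne_zero] using hdet : A.det = 0)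
  have h1 := hA (WithLp.toLp 2 v)
  rw [mbilin_eq_dotProduct, hAv, dotProduct_zero] at h1
  have h2 : 0 < ‖(WithLp.toLp 2 v : Euc n)‖ := norm_pos_iff.2 (by simpa using hv)
  have : 0 < C⁻¹ * ‖(WithLp.toLp 2 v : Euc n)‖ ^ 2 := by positivity
  linarith

theorem mbilin_inv_mulVec (hA : IsUnit A.det) (η : Euc n) :
    mbilin A⁻¹ (WithLp.toLp 2 (A *ᵥ η.ofLp)) (WithLp.toLp 2 (A *ᵥ η.ofLp)) = mbilin A η η := by
  rw [mbilin_eq_dotProduct, mbilin_eq_dotProduct, mulVec_mulVec, nonsing_inv_mul A hA, one_mulVec,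
    dotProduct_comm]

theorem mbilin_inv_bounds (hC : 0 < C) (hA : ∀ ξ : Euc n, C⁻¹ * ‖ξ‖ ^ 2 ≤ mbilin A ξ ξ)
    (ξ : Euc n) : 0 ≤ mbilin A⁻¹ ξ ξ ∧ mbilin A⁻¹ ξ ξ ≤ C * ‖ξ‖ ^ 2 := by
  have hu := isUnit_det_of_elliptic hC hA
  set η : Euc n := WithLp.toLp 2 (A⁻¹ *ᵥ ξ.ofLp)
  have hξ : ξ = WithLp.toLp 2 (A *ᵥ η.ofLp) := by
    simp [η, mulVec_mulVec, mul_nonsing_inv A hu]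
  have h1 : mbilin A⁻¹ ξ ξ = mbilin A η η := by
    conv_lhs => rw [hξ]
    exact mbilin_inv_mulVec hu η
  have h2 : mbilin A⁻¹ ξ ξ ≤ ‖ξ‖ * ‖η‖ :=
    (inner_toLp_mulVec A⁻¹ ξ ξ).symm.trans_le (real_inner_le_norm ξ η)
  have h3 := hA η
  have hC' : 0 < C⁻¹ := inv_pos.2 hC
  refine ⟨h1 ▸ (by positivity : (0 : ℝ) ≤ C⁻¹ * ‖η‖ ^ 2).trans h3, ?_⟩
  have h4 : ‖η‖ ≤ C * ‖ξ‖ := by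
    rcases (norm_nonneg η).eq_or_lt with h0 | h0
    · rw [← h0]; positivity
    · have h5 : C⁻¹ * ‖η‖ ^ 2 ≤ ‖ξ‖ * ‖η‖ := h3.trans (h1 ▸ h2)
      have h6 : C⁻¹ * ‖η‖ ≤ ‖ξ‖ := le_of_mul_le_mul_right (by linarith) h0
      rwa [inv_mul_le_iff₀ hC] at h6
  calc mbilin A⁻¹ ξ ξ ≤ ‖ξ‖ * ‖η‖ := h2
    _ ≤ ‖ξ‖ * (C * ‖ξ‖) := by gcongr
    _ = C * ‖ξ‖ ^ 2 := by ring

theorem continuousOn_inv_apply {X : Type*} [TopologicalSpace X] {s : Set X}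
    {A : X → Matrix (Fin n) (Fin n) ℝ} (hA : ∀ i j, ContinuousOn (fun x => A x i j) s)
    (hdet : ∀ x ∈ s, IsUnit (A x).det) (i j : Fin n) :
    ContinuousOn (fun x => (A x)⁻¹ i j) s := by
  have hA' : ContinuousOn A s := continuousOn_pi.2 fun i => continuousOn_pi.2 fun j => hA i j
  have hd : ContinuousOn (fun x => (A x).det⁻¹) s :=
    ((continuous_id.matrix_det).comp_continuousOn hA').inv₀ fun x hx => (hdet x hx).ne_zero
  have ha : ContinuousOn (fun x => (A x).adjugate i j) s :=
    ((continuous_id.matrix_adjugate).matrix_elem i j).comp_continuousOn hA'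
  refine (hd.mul ha).congr fun x _ => ?_
  rw [inv_def, Matrix.smul_apply, Ring.inverse_eq_inv', smul_eq_mul]
  rfl

end MatrixForm

section Concatenation

variable {F : Type*}

/-- Concatenation of the functions `u₁` and `u₂` on `[0,1]`, run at double speed. -/
def pathConcat (u₁ u₂ : ℝ → F) (t : ℝ) : F :=
  if t ≤ 1 / 2 then u₁ (2 * t) else u₂ (2 * t - 1)

variable {u₁ u₂ : ℝ → F}

theorem pathConcat_eqOn_left {s : ℝ} (hs : s ≤ 1 / 2) (hs0 : 0 ≤ s) :
    EqOn (fun t => u₁ (2 * t)) (pathConcat u₁ u₂) (uIoc 0 s) := by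
  intro t ht
  rw [uIoc_of_le hs0] at ht
  simp only [pathConcat]
  rw [if_pos (ht.2.trans hs)]

theorem pathConcat_eqOn_right {s : ℝ} (hs : 1 / 2 ≤ s) :
    EqOn (fun t => u₂ (2 * t - 1)) (pathConcat u₁ u₂) (uIoc (1 / 2) s) := by
  intro t ht
  rw [uIoc_of_le hs] at ht
  simp only [pathConcat]
  rw [if_neg (not_le.2 ht.1)]

variable [NormedAddCommGroup F]

theorem intervalIntegrable_pathConcat_left (h₁ : IntervalIntegrable u₁ volume 0 1) :
    IntervalIntegrable (pathConcat u₁ u₂) volume 0 (1 / 2) := by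
  have h := h₁.comp_mul_left (c := 2)
  rw [zero_div] at h
  exact (intervalIntegrable_congr (pathConcat_eqOn_left le_rfl (by norm_num))).1 h

theorem intervalIntegrable_pathConcat_right (h₂ : IntervalIntegrable u₂ volume 0 1) :
    IntervalIntegrable (pathConcat u₁ u₂) volume (1 / 2) 1 := by
  have h := (h₂.comp_sub_right 1).comp_mul_left (c := 2)
  norm_num at h
  exact (intervalIntegrable_congr (pathConcat_eqOn_right (by norm_num))).1 (by simpa using h)

theorem intervalIntegrable_pathConcat (h₁ : IntervalIntegrable u₁ volume 0 1)
    (h₂ : IntervalIntegrable u₂ volume 0 1) :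
    IntervalIntegrable (pathConcat u₁ u₂) volume 0 1 :=
  (intervalIntegrable_pathConcat_left h₁).trans (intervalIntegrable_pathConcat_right h₂)

variable [NormedSpace ℝ F]

theorem two_smul_integral_pathConcat_left {s : ℝ} (hs0 : 0 ≤ s) (hs : s ≤ 1 / 2) :
    (2 : ℝ) • ∫ t in (0 : ℝ)..s, pathConcat u₁ u₂ t = ∫ t in (0 : ℝ)..2 * s, u₁ t := by
  rw [← intervalIntegral.integral_congr_ae (ae_of_all _ (pathConcat_eqOn_left hs hs0)),
    intervalIntegral.smul_integral_comp_mul_left, mul_zero]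

theorem two_smul_integral_pathConcat_right (h₁ : IntervalIntegrable u₁ volume 0 1)
    (h₂ : IntervalIntegrable u₂ volume 0 1) {s : ℝ} (hs : 1 / 2 ≤ s) (hs1 : s ≤ 1) :
    (2 : ℝ) • ∫ t in (0 : ℝ)..s, pathConcat u₁ u₂ t =
      (∫ t in (0 : ℝ)..1, u₁ t) + ∫ t in (0 : ℝ)..2 * s - 1, u₂ t := by
  have h3 : IntervalIntegrable (pathConcat u₁ u₂) volume (1 / 2) s :=
    (intervalIntegrable_pathConcat_right h₂).mono_set (by
      rw [uIcc_of_le hs, uIcc_of_le (hs.trans hs1)]; exact Icc_subset_Icc_right hs1)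
  rw [← intervalIntegral.integral_add_adjacent_intervals
    (intervalIntegrable_pathConcat_left h₁) h3, smul_add,
    two_smul_integral_pathConcat_left (by norm_num) le_rfl,
    ← intervalIntegral.integral_congr_ae (ae_of_all _ (pathConcat_eqOn_right hs)),
    intervalIntegral.smul_integral_comp_mul_sub]
  norm_num

theorem ACPath.concat {n : ℕ} {M : Set (Euc n)} {x y z : Euc n} {γ₁ γ₂ dγ₁ dγ₂ : ℝ → Euc n}
    (h₁ : ACPath M x y γ₁ dγ₁) (h₂ : ACPath M y z γ₂ dγ₂) :
    ACPath M x z (pathConcat γ₁ γ₂) (fun t => (2 : ℝ) • pathConcat dγ₁ dγ₂ t) := by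
  obtain ⟨h10, h11, h1M, h1i, h1⟩ := h₁
  obtain ⟨h20, h21, h2M, h2i, h2⟩ := h₂
  refine ⟨by simp [pathConcat, h10], ?_, fun t ht => ?_,
    (intervalIntegrable_pathConcat h1i h2i).smul (2 : ℝ), fun s hs => ?_⟩
  · norm_num [pathConcat, h21]
  · simp only [pathConcat]
    split_ifs with h
    · exact h1M _ ⟨by linarith [ht.1], by linarith⟩
    · exact h2M _ ⟨by linarith [not_le.1 h], by linarith [ht.2]⟩
  · rw [intervalIntegral.integral_smul]
    rcases le_or_gt s (1 / 2) with h | h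
    · rw [two_smul_integral_pathConcat_left hs.1 h, ← h1 _ ⟨by linarith [hs.1], by linarith⟩]
      simp only [pathConcat]
      rw [if_pos h]
    · rw [two_smul_integral_pathConcat_right h1i h2i h.le hs.2, ← add_assoc,
        ← h1 1 (right_mem_Icc.2 zero_le_one), h11, ← h2 _ ⟨by linarith, by linarith [hs.2]⟩]
      simp only [pathConcat]
      rw [if_neg (not_le.2 h)]

end Concatenation

section LipschitzACPath

/-- A Lipschitz path is absolutely continuous. -/
theorem exists_acPath_of_lipschitzOnWith {n : ℕ} {M : Set (Euc n)} {K : ℝ≥0} {γ : ℝ → Euc n}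
    (hM : MapsTo γ (Icc 0 1) M) (hγ : LipschitzOnWith K γ (Icc 0 1)) :
    ∃ dγ : ℝ → Euc n, ACPath M (γ 0) (γ 1) γ dγ ∧ ∀ t ∈ Ioo (0 : ℝ) 1, ‖dγ t‖ ≤ n * K := by
  have hcoord : ∀ i, LipschitzOnWith K (fun t => γ t i) (Icc 0 1) := fun i =>
    LipschitzOnWith.of_dist_le_mul fun s hs t ht =>
      ((EuclideanSpace.dist_eq (γ s) (γ t)).symm ▸ Real.le_sqrt_of_sq_le
        (Finset.single_le_sum (f := fun i => dist (γ s i) (γ t i) ^ 2)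
          (fun _ _ => sq_nonneg _) (Finset.mem_univ i)) :
        dist (γ s i) (γ t i) ≤ dist (γ s) (γ t)).trans (hγ.dist_le_mul s hs t ht)
  set dγ : ℝ → Euc n := fun t => WithLp.toLp 2 fun i => deriv (fun s => γ s i) t
  have hbd : ∀ t ∈ Ioo (0 : ℝ) 1, ‖dγ t‖ ≤ n * K := by
    intro t ht
    have h1 : ∀ i, |dγ t i| ≤ K := fun i =>
      norm_deriv_le_of_lipschitzOn (Icc_mem_nhds ht.1 ht.2) (hcoord i)
    calc ‖dγ t‖ = ‖∑ i, EuclideanSpace.single i (dγ t i)‖ := by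
          congr 1
          ext j
          simp [Finset.sum_apply]
      _ ≤ ∑ i, |dγ t i| := (norm_sum_le _ _).trans (by simp)
      _ ≤ ∑ _i : Fin n, (K : ℝ) := Finset.sum_le_sum fun i _ => h1 i
      _ = n * K := by simp
  have hmeas : Measurable dγ := by
    refine (MeasurableEquiv.toLp 2 (Fin n → ℝ)).measurable.comp ?_
    exact measurable_pi_lambda _ fun i => measurable_deriv _
  have hint : IntervalIntegrable dγ volume 0 1 := by
    rw [intervalIntegrable_iff_integrableOn_Ioo_of_le zero_le_one]
    refine Measure.integrableOn_of_bounded (M := n * K) (by simp)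
      hmeas.aestronglyMeasurable ?_
    exact (ae_restrict_mem measurableSet_Ioo).mono fun t ht => hbd t ht
  refine ⟨dγ, ⟨rfl, rfl, hM, hint, fun s hs => ?_⟩, hbd⟩
  have hint' : IntervalIntegrable dγ volume 0 s := hint.mono_set (by
    rw [uIcc_of_le hs.1, uIcc_of_le zero_le_one]; exact Icc_subset_Icc_right hs.2)
  ext i
  have h1 : (∫ t in (0 : ℝ)..s, dγ t) i = ∫ t in (0 : ℝ)..s, dγ t i :=
    ((EuclideanSpace.proj (𝕜 := ℝ) i).intervalIntegral_comp_comm hint').symm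
  have h2 : AbsolutelyContinuousOnInterval (fun t => γ t i) 0 s := by
    refine LipschitzOnWith.absolutelyContinuousOnInterval (K := K) ((hcoord i).mono ?_)
    rw [uIcc_of_le hs.1]
    exact Icc_subset_Icc_right hs.2
  rw [PiLp.add_apply, h1]
  have h3 := h2.integral_deriv_eq_sub
  simp only [dγ]
  rw [h3]
  ring

end LipschitzACPath

section Agmon

open Topology

variable {n : ℕ}

/-- The length of the tangent vector `ξ` at `x` in the degenerate Agmon metric. -/
def agmonSpeed (A : Euc n → Matrix (Fin n) (Fin n) ℝ) (w : Euc n → ℝ) (x ξ : Euc n) : ℝ :=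
  √(w x * mbilin (A x)⁻¹ ξ ξ)

/-- The standing assumptions on the coefficients of the Agmon metric on `M`. -/
structure AgmonRegular (M : Set (Euc n)) (C : ℝ) (A : Euc n → Matrix (Fin n) (Fin n) ℝ)
    (w : Euc n → ℝ) : Prop where
  isCompact : IsCompact M
  pos : 0 < C
  continuousOn_apply : ∀ i j, ContinuousOn (fun x => A x i j) M
  elliptic : UniformlyElliptic M C A
  continuousOn_weight : ContinuousOn w M
  weight_nonneg : ∀ x ∈ M, 0 ≤ w x

variable {M : Set (Euc n)} {C : ℝ} {A : Euc n → Matrix (Fin n) (Fin n) ℝ} {w : Euc n → ℝ}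
  {x y z : Euc n} {γ dγ : ℝ → Euc n}

theorem agmonSpeed_nonneg (x ξ : Euc n) : 0 ≤ agmonSpeed A w x ξ := Real.sqrt_nonneg _

theorem agmonSpeed_smul (x : Euc n) (c : ℝ) (ξ : Euc n) :
    agmonSpeed A w x (c • ξ) = |c| * agmonSpeed A w x ξ := by
  rw [agmonSpeed, agmonSpeed, mbilin_smul_smul, mul_left_comm, Real.sqrt_mul (sq_nonneg c),
    Real.sqrt_sq_eq_abs]

theorem agmonLen_nonneg : 0 ≤ agmonLen A w γ dγ :=
  intervalIntegral.integral_nonneg zero_le_one fun _ _ => Real.sqrt_nonneg _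

theorem agmonLen_le_of_ae {K : ℝ}
    (h : ∀ᵐ t : ℝ, t ∈ Ioc 0 1 → agmonSpeed A w (γ t) (dγ t) ≤ K) : agmonLen A w γ dγ ≤ K := by
  have h1 : ‖∫ t in (0 : ℝ)..1, agmonSpeed A w (γ t) (dγ t)‖ ≤ K * |1 - 0| :=
    intervalIntegral.norm_integral_le_of_norm_le_const_ae (h.mono fun t ht hmem => by
      rw [Real.norm_of_nonneg (agmonSpeed_nonneg _ _)]
      exact ht (by rwa [uIoc_of_le zero_le_one] at hmem))
  rw [sub_zero, abs_one, mul_one] at h1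
  exact (le_abs_self _).trans h1

theorem agmonDist_nonneg : 0 ≤ AgmonDist M A w x y := by
  refine Real.sInf_nonneg ?_
  rintro _ ⟨γ, dγ, -, rfl⟩
  exact agmonLen_nonneg

theorem ACPath.agmonDist_le (h : ACPath M x y γ dγ) : AgmonDist M A w x y ≤ agmonLen A w γ dγ := by
  refine csInf_le ⟨0, ?_⟩ ⟨γ, dγ, h, rfl⟩
  rintro _ ⟨γ, dγ, -, rfl⟩
  exact agmonLen_nonneg

theorem ACPath.continuousOn (h : ACPath M x y γ dγ) : ContinuousOn γ (Icc 0 1) := by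
  obtain ⟨-, -, -, hi, hγ⟩ := h
  have h1 := intervalIntegral.continuousOn_primitive_interval' hi left_mem_uIcc
  rw [uIcc_of_le zero_le_one] at h1
  exact (continuousOn_const.add h1).congr hγ

theorem ACPath.agmonLen_le {B : ℝ≥0} {K : ℝ} (h : ACPath M x y γ dγ)
    (hB : ∀ x ∈ M, ∀ ξ, agmonSpeed A w x ξ ≤ B * ‖ξ‖)
    (hK : ∀ t ∈ Ioo (0 : ℝ) 1, ‖dγ t‖ ≤ K) : agmonLen A w γ dγ ≤ B * K := by
  have h1 : ∀ᵐ t : ℝ, t ≠ 1 := by simp [ae_iff]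
  refine agmonLen_le_of_ae (h1.mono fun t ht1 ht => ?_)
  refine (hB _ (h.2.2.1 t (Ioc_subset_Icc_self ht)) _).trans ?_
  gcongr
  exact hK t ⟨ht.1, lt_of_le_of_ne ht.2 ht1⟩

namespace AgmonRegular

theorem isUnit_det (hr : AgmonRegular M C A w) (hx : x ∈ M) : IsUnit (A x).det :=
  isUnit_det_of_elliptic hr.pos fun ξ => (hr.elliptic x hx ξ).1

theorem continuousOn_inv_apply (hr : AgmonRegular M C A w) (i j : Fin n) :
    ContinuousOn (fun x => (A x)⁻¹ i j) M :=
  _root_.continuousOn_inv_apply hr.continuousOn_apply (fun _ hx => hr.isUnit_det hx) i j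

theorem continuousOn_agmonSpeed (hr : AgmonRegular M C A w) (ξ : Euc n) :
    ContinuousOn (fun x => agmonSpeed A w x ξ) M := by
  refine (hr.continuousOn_weight.mul ?_).sqrt
  exact continuousOn_finsetSum _ fun i _ => continuousOn_finsetSum _ fun j _ =>
    ((hr.continuousOn_inv_apply i j).mul continuousOn_const).mul continuousOn_const

theorem exists_agmonSpeed_le (hr : AgmonRegular M C A w) :
    ∃ B : ℝ≥0, ∀ x ∈ M, ∀ ξ, agmonSpeed A w x ξ ≤ B * ‖ξ‖ := by
  obtain ⟨W, hW⟩ := hr.isCompact.exists_bound_of_continuousOn hr.continuousOn_weight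
  have hC := hr.pos
  refine ⟨NNReal.sqrt (|W| * C).toNNReal, fun x hx ξ => ?_⟩
  refine Real.sqrt_le_iff.2 ⟨by positivity, ?_⟩
  rw [mul_pow, Real.coe_sqrt, Real.coe_toNNReal _ (by positivity), Real.sq_sqrt (by positivity)]
  obtain ⟨h0, h1⟩ := mbilin_inv_bounds hr.pos (fun ξ => (hr.elliptic x hx ξ).1) ξ
  have h2 : w x ≤ |W| := (le_abs_self _).trans ((hW x hx).trans (le_abs_self _))
  calc w x * mbilin (A x)⁻¹ ξ ξ ≤ |W| * (C * ‖ξ‖ ^ 2) := by gcongr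
    _ = |W| * C * ‖ξ‖ ^ 2 := by ring

theorem intervalIntegrable_agmonSpeed (hr : AgmonRegular M C A w) (h : ACPath M x y γ dγ) :
    IntervalIntegrable (fun t => agmonSpeed A w (γ t) (dγ t)) volume 0 1 := by
  obtain ⟨B, hB⟩ := hr.exists_agmonSpeed_le
  have hc := h.continuousOn
  obtain ⟨-, -, hM, hi, -⟩ := h
  have hi' : IntegrableOn dγ (Icc 0 1) :=
    (intervalIntegrable_iff_integrableOn_Icc_of_le zero_le_one).1 hi
  rw [intervalIntegrable_iff_integrableOn_Icc_of_le zero_le_one]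
  have hmeas : ∀ {f : Euc n → ℝ}, ContinuousOn f M →
      AEStronglyMeasurable (fun t => f (γ t)) (volume.restrict (Icc 0 1)) := fun hf =>
    (hf.comp hc hM).aestronglyMeasurable measurableSet_Icc
  have hcoord : ∀ i, AEStronglyMeasurable (fun t => dγ t i) (volume.restrict (Icc 0 1)) := fun i =>
    (EuclideanSpace.proj (𝕜 := ℝ) i).continuous.comp_aestronglyMeasurable
      hi'.aestronglyMeasurable
  refine Integrable.mono' (hi'.norm.const_mul (B : ℝ)) ?_ ?_
  · refine Real.continuous_sqrt.comp_aestronglyMeasurable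
      ((hmeas hr.continuousOn_weight).mul ?_)
    refine Finset.aestronglyMeasurable_fun_sum _ fun i _ =>
      Finset.aestronglyMeasurable_fun_sum _ fun j _ => ?_
    exact ((hmeas (hr.continuousOn_inv_apply i j)).mul (hcoord i)).mul (hcoord j)
  · refine (ae_restrict_mem measurableSet_Icc).mono fun t ht => ?_
    rw [Real.norm_of_nonneg (agmonSpeed_nonneg _ _)]
    exact hB _ (hM t ht) _

theorem agmonLen_concat (hr : AgmonRegular M C A w) {γ₁ γ₂ dγ₁ dγ₂ : ℝ → Euc n}
    (h₁ : ACPath M x y γ₁ dγ₁) (h₂ : ACPath M y z γ₂ dγ₂) :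
    agmonLen A w (pathConcat γ₁ γ₂) (fun t => (2 : ℝ) • pathConcat dγ₁ dγ₂ t) =
      agmonLen A w γ₁ dγ₁ + agmonLen A w γ₂ dγ₂ := by
  have h := two_smul_integral_pathConcat_right (hr.intervalIntegrable_agmonSpeed h₁)
    (hr.intervalIntegrable_agmonSpeed h₂) (s := 1) (by norm_num) le_rfl
  rw [show (2 : ℝ) * 1 - 1 = 1 by norm_num, ← intervalIntegral.integral_smul] at h
  refine Eq.trans (intervalIntegral.integral_congr fun t _ => ?_) h
  change agmonSpeed A w _ _ = _
  rw [agmonSpeed_smul, abs_two]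
  simp only [pathConcat]
  split_ifs <;> rfl

theorem agmonDist_triangle (hr : AgmonRegular M C A w) (hxy : ∃ γ dγ, ACPath M x y γ dγ)
    (hyz : ∃ γ dγ, ACPath M y z γ dγ) :
    AgmonDist M A w x z ≤ AgmonDist M A w x y + AgmonDist M A w y z := by
  refine le_of_forall_pos_lt_add fun ε hε => ?_
  obtain ⟨γ, dγ, h⟩ := hxy
  obtain ⟨γ', dγ', h'⟩ := hyz
  obtain ⟨_, ⟨γ₁, dγ₁, h₁, rfl⟩, hL₁⟩ := exists_lt_of_csInf_lt
    (s := {L | ∃ γ dγ, ACPath M x y γ dγ ∧ L = agmonLen A w γ dγ}) ⟨_, γ, dγ, h, rfl⟩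
    (lt_add_of_pos_right _ (half_pos hε))
  obtain ⟨_, ⟨γ₂, dγ₂, h₂, rfl⟩, hL₂⟩ := exists_lt_of_csInf_lt
    (s := {L | ∃ γ dγ, ACPath M y z γ dγ ∧ L = agmonLen A w γ dγ}) ⟨_, γ', dγ', h', rfl⟩
    (lt_add_of_pos_right _ (half_pos hε))
  have h3 := (h₁.concat h₂).agmonDist_le (A := A) (w := w)
  rw [hr.agmonLen_concat h₁ h₂] at h3
  change _ < AgmonDist M A w x y + _ at hL₁
  change _ < AgmonDist M A w y z + _ at hL₂
  linarith

/-- A function whose increments are bounded by the Agmon distance satisfies the eikonal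
inequality at each interior point of differentiability. -/
theorem mbilin_gradient_le (hr : AgmonRegular M C A w) {h : Euc n → ℝ} (hx : M ∈ 𝓝 x)
    (hd : DifferentiableAt ℝ h x) (hh : ∀ y ∈ M, h y - h x ≤ AgmonDist M A w y x) :
    mbilin (A x) (gradient h x) (gradient h x) ≤ w x := by
  have hxM := mem_of_mem_nhds hx
  set g := gradient h x
  set m := mbilin (A x) g g
  set v : Euc n := WithLp.toLp 2 (Matrix.mulVec (A x) g.ofLp)
  have hgv : ⟪g, v⟫ = m := inner_toLp_mulVec _ _ _
  have hvm : mbilin (A x)⁻¹ v v = m := mbilin_inv_mulVec (hr.isUnit_det hxM) g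
  have hm0 : 0 ≤ m := by
    have h1 := (hr.elliptic x hxM g).1
    have := hr.pos
    exact le_trans (by positivity) h1
  have hdir : HasDerivAt (fun t : ℝ => h (x + t • v)) m 0 := by
    have h1 : HasFDerivAt h (InnerProductSpace.toDual ℝ (Euc n) g) (x + (0 : ℝ) • v) := by
      rw [zero_smul, add_zero]
      exact hd.hasGradientAt.hasFDerivAt
    have h2 : HasDerivAt (fun t : ℝ => x + t • v) v 0 := by
      simpa using ((hasDerivAt_id (0 : ℝ)).smul_const v).const_add x
    have h3 := h1.comp_hasDerivAt 0 h2
    rwa [InnerProductSpace.toDual_apply_apply, hgv] at h3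
  have key : m ≤ agmonSpeed A w x v := by
    refine le_of_forall_pos_le_add fun ε hε => ?_
    refine le_of_tendsto hdir.tendsto_slope_zero_right ?_
    have hev : ∀ᶠ y in 𝓝 x, y ∈ M ∧ agmonSpeed A w y v < agmonSpeed A w x v + ε :=
      (eventually_mem_set.2 hx).and (((hr.continuousOn_agmonSpeed v).continuousAt hx).eventually
        (gt_mem_nhds (lt_add_of_pos_right _ hε)))
    obtain ⟨δ, hδ, hball⟩ := Metric.eventually_nhds_iff_ball.1 hev
    have hsmall : ∀ᶠ t : ℝ in 𝓝[>] 0, t * ‖v‖ < δ := by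
      refine nhdsWithin_le_nhds (ContinuousAt.eventually_lt (by fun_prop) continuousAt_const ?_)
      simpa using hδ
    filter_upwards [hsmall, self_mem_nhdsWithin] with t ht ht0
    have ht0' : 0 < t := ht0
    have hline : ∀ s ∈ Icc (0 : ℝ) 1, x + ((1 - s) * t) • v ∈ ball x δ := by
      intro s hs
      rw [mem_ball, dist_eq_norm, add_sub_cancel_left, norm_smul, Real.norm_of_nonneg
        (mul_nonneg (by linarith [hs.2]) ht0'.le)]
      refine lt_of_le_of_lt ?_ ht
      gcongr
      nlinarith [hs.1]
    have hpath : ACPath M (x + t • v) x (fun s => x + ((1 - s) * t) • v)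
        (fun _ => (-t) • v) := by
      refine ⟨by simp, by simp, fun s hs => (hball _ (hline s hs)).1,
        intervalIntegrable_const, fun s _ => ?_⟩
      rw [intervalIntegral.integral_const, smul_smul, add_assoc, ← add_smul]
      rw [show t + (s - 0) * -t = (1 - s) * t by ring]
    have hlen : agmonLen A w (fun s => x + ((1 - s) * t) • v) (fun _ => (-t) • v) ≤
        t * (agmonSpeed A w x v + ε) := by
      refine agmonLen_le_of_ae (ae_of_all _ fun s hs => ?_)
      rw [agmonSpeed_smul, abs_neg, abs_of_pos ht0']
      gcongr
      exact (hball _ (hline s (Ioc_subset_Icc_self hs))).2.le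
    have h4 : h (x + t • v) - h x ≤ t * (agmonSpeed A w x v + ε) := by
      have hmem := hpath.2.2.1 0 (left_mem_Icc.2 zero_le_one)
      rw [hpath.1] at hmem
      exact (hh _ hmem).trans (hpath.agmonDist_le.trans hlen)
    rw [zero_add, zero_smul, add_zero, smul_eq_mul, inv_mul_le_iff₀ ht0']
    exact h4
  rw [agmonSpeed, hvm] at key
  rcases hm0.eq_or_lt with h0 | h0
  · exact h0 ▸ hr.weight_nonneg x hxM
  · have h5 : m ^ 2 ≤ w x * m := by
      rw [← Real.sq_sqrt (mul_nonneg (hr.weight_nonneg x hxM) hm0)]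
      gcongr
    nlinarith

variable {Ω : Set (Euc n)}

theorem exists_agmonDist_le_mul_dist (hr : AgmonRegular (closure Ω) C A w) (hΩo : IsOpen Ω)
    (hΩl : BiLipschitzBoundary Ω) (hx : x ∈ closure Ω) :
    ∃ s > 0, ∃ c : ℝ≥0, ∀ y ∈ closure Ω ∩ ball x s, ∀ z ∈ closure Ω ∩ ball x s,
      (∃ γ dγ, ACPath (closure Ω) y z γ dγ) ∧ AgmonDist (closure Ω) A w y z ≤ c * dist y z := by
  obtain ⟨s, hs, c, hc⟩ := hΩl.exists_lipschitz_path hΩo hx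
  obtain ⟨B, hB⟩ := hr.exists_agmonSpeed_le
  refine ⟨s, hs, B * (n * c), fun y hy z hz => ?_⟩
  obtain ⟨γ, rfl, rfl, hM, hγ⟩ := hc y hy z hz
  obtain ⟨dγ, hp, hK⟩ := exists_acPath_of_lipschitzOnWith hM hγ
  refine ⟨⟨γ, dγ, hp⟩, (hp.agmonDist_le.trans (hp.agmonLen_le hB hK)).trans_eq ?_⟩
  simp only [NNReal.coe_mul, NNReal.coe_natCast, coe_nndist]
  ring

theorem exists_acPath (hr : AgmonRegular (closure Ω) C A w) (hΩo : IsOpen Ω)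
    (hΩc : IsConnected Ω) (hΩl : BiLipschitzBoundary Ω) (hx : x ∈ closure Ω)
    (hy : y ∈ closure Ω) : ∃ γ dγ, ACPath (closure Ω) x y γ dγ := by
  refine hΩc.isPreconnected.closure.induction₂' (fun x y => ∃ γ dγ, ACPath (closure Ω) x y γ dγ)
    (fun x hx => ?_) ?_ hx hy
  · obtain ⟨s, hs, c, hc⟩ := hr.exists_agmonDist_le_mul_dist hΩo hΩl hx
    filter_upwards [self_mem_nhdsWithin, mem_nhdsWithin_of_mem_nhds (ball_mem_nhds x hs)]
      with y hy hys
    exact ⟨(hc x ⟨hx, mem_ball_self hs⟩ y ⟨hy, hys⟩).1,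
      (hc y ⟨hy, hys⟩ x ⟨hx, mem_ball_self hs⟩).1⟩
  · rintro x y z - - - ⟨γ₁, dγ₁, h₁⟩ ⟨γ₂, dγ₂, h₂⟩
    exact ⟨_, _, h₁.concat h₂⟩

theorem lipschitz_and_ae_mbilin_gradient_le (hr : AgmonRegular (closure Ω) C A w)
    (hΩo : IsOpen Ω) (hΩl : BiLipschitzBoundary Ω) {h : Euc n → ℝ}
    (hh : ∀ x ∈ closure Ω, ∀ y ∈ closure Ω, h x - h y ≤ AgmonDist (closure Ω) A w x y) :
    (∃ c : ℝ≥0, LipschitzOnWith c h (closure Ω)) ∧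
      ∀ᵐ x ∂(volume.restrict Ω),
        DifferentiableAt ℝ h x ∧ mbilin (A x) (gradient h x) (gradient h x) ≤ w x := by
  have hloc : LocallyLipschitzOn (closure Ω) h := by
    intro x hx
    obtain ⟨s, hs, c, hc⟩ := hr.exists_agmonDist_le_mul_dist hΩo hΩl hx
    refine ⟨c, closure Ω ∩ ball x s,
      inter_mem self_mem_nhdsWithin (mem_nhdsWithin_of_mem_nhds (ball_mem_nhds x hs)),
      LipschitzOnWith.of_le_add_mul c fun y hy z hz => ?_⟩
    linarith [hh y hy.1 z hz.1, (hc y hy z hz).2]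
  obtain ⟨c, hc⟩ := hloc.exists_lipschitzOnWith_of_compact hr.isCompact
  refine ⟨⟨c, hc⟩, ?_⟩
  filter_upwards [ae_restrict_of_ae (hc.ae_differentiableWithinAt_of_mem (μ := volume)),
    ae_restrict_mem hΩo.measurableSet] with x hd hx
  have hxM : closure Ω ∈ 𝓝 x := mem_of_superset (hΩo.mem_nhds hx) subset_closure
  have hd' := (hd (subset_closure hx)).differentiableAt hxM
  exact ⟨hd', hr.mbilin_gradient_le hxM hd' fun y hy => hh y hy x (subset_closure hx)⟩

theorem agmonDistSet_sub_le (hr : AgmonRegular (closure Ω) C A w) (hΩo : IsOpen Ω)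
    (hΩc : IsConnected Ω) (hΩl : BiLipschitzBoundary Ω) {E : Set (Euc n)}
    (hE : E ⊆ closure Ω) (hne : E.Nonempty) (hx : x ∈ closure Ω) (hy : y ∈ closure Ω) :
    AgmonDistSet (closure Ω) A w x E - AgmonDistSet (closure Ω) A w y E ≤
      AgmonDist (closure Ω) A w x y := by
  rw [sub_le_comm]
  obtain ⟨e₀, he₀⟩ := hne
  refine le_csInf ⟨_, e₀, he₀, rfl⟩ ?_
  rintro _ ⟨e, he, rfl⟩
  have h1 := hr.agmonDist_triangle (hr.exists_acPath hΩo hΩc hΩl hx hy)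
    (hr.exists_acPath hΩo hΩc hΩl hy (hE he))
  have h2 : AgmonDistSet (closure Ω) A w x E ≤ AgmonDist (closure Ω) A w x e := by
    refine csInf_le ⟨0, ?_⟩ ⟨e, he, rfl⟩
    rintro _ ⟨e, -, rfl⟩
    exact agmonDist_nonneg
  linarith

end AgmonRegular

end Agmon

/-- **Lemma 3.3 (Agmon, [Agm] Theorem 4 p. 18).**  Let `A` be continuous on `M` and `w ≥ 0`
continuous on `M`, with Agmon distance `ρ`.  If `|h(x) − h(y)| ≤ ρ(x,y)` on `M`, then `h` is
Lipschitz and `|∇_A h(x)|² = (A∇h)·∇h ≤ w(x)` at almost every `x ∈ M` (`h` is differentiable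
a.e. by Rademacher).  In particular the conclusion holds for `h(x) = inf_{y∈E} ρ(x,y)` for any
nonempty `E ⊆ M`. -/
theorem agmon_distance_gradient_bound
    {n : ℕ} (Ω : Set (Euc n)) (hΩo : IsOpen Ω) (hΩb : Bornology.IsBounded Ω)
    (hΩc : IsConnected Ω) (hΩl : BiLipschitzBoundary Ω)
    (C : ℝ) (hC : 0 < C)
    (A : Euc n → Matrix (Fin n) (Fin n) ℝ)
    (hA_cont : ∀ i j, ContinuousOn (fun x => A x i j) (closure Ω))
    (hA_symm : ∀ x ∈ closure Ω, ∀ i j, A x i j = A x j i)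
    (hA_ell : UniformlyElliptic (closure Ω) C A)
    (w : Euc n → ℝ) (hw_cont : ContinuousOn w (closure Ω))
    (hw_nonneg : ∀ x ∈ closure Ω, 0 ≤ w x)
    (h : Euc n → ℝ)
    (hcontr : ∀ x ∈ closure Ω, ∀ y ∈ closure Ω,
      |h x - h y| ≤ AgmonDist (closure Ω) A w x y) :
    ((∃ c : NNReal, LipschitzOnWith c h (closure Ω)) ∧
      ∀ᵐ x ∂(volume.restrict Ω),
        DifferentiableAt ℝ h x ∧ mbilin (A x) (gradient h x) (gradient h x) ≤ w x) ∧
    (∀ E : Set (Euc n), E ⊆ closure Ω → E.Nonempty →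
      (∃ c : NNReal,
          LipschitzOnWith c (fun x => AgmonDistSet (closure Ω) A w x E) (closure Ω)) ∧
      ∀ᵐ x ∂(volume.restrict Ω),
        DifferentiableAt ℝ (fun y => AgmonDistSet (closure Ω) A w y E) x ∧
          mbilin (A x) (gradient (fun y => AgmonDistSet (closure Ω) A w y E) x)
            (gradient (fun y => AgmonDistSet (closure Ω) A w y E) x) ≤ w x) := by
  have hr : AgmonRegular (closure Ω) C A w :=
    ⟨hΩb.isCompact_closure, hC, hA_cont, hA_ell, hw_cont, hw_nonneg⟩
  exact ⟨hr.lipschitz_and_ae_mbilin_gradient_le hΩo hΩl fun x hx y hy =>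
      (le_abs_self _).trans (hcontr x hx y hy),
    fun _E hE hne => hr.lipschitz_and_ae_mbilin_gradient_le hΩo hΩl fun _ hx _ hy =>
      hr.agmonDistSet_sub_le hΩo hΩc hΩl hE hne hx hy⟩

end
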